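/- Let d ≥ 2 be an integer. For every θ ∈ ℝ^d with θ ≠ 0, ∫_{ℝ^d} ((θ+x)/‖θ+x‖) · f(x) dx = θ · (√(1+‖θ‖²) − 1)/‖θ‖². In other words, the distribution with density f on ℝ^d is a 1-self-concordant perturbation for the unit Euclidean ball 𝔹^d replicating the 1-self-concordant barrier R(z) = −ln(1−‖z‖²), whose conjugate satisfies ∇R*(θ) = θ(√(1+‖θ‖²)−1)/‖θ‖². -/

import Mathlib

noncomputable section
open MeasureTheory ProbabilityTheory Real Filter Topology Matrix
open scoped RealInnerProductSpace

/-- `E d` is the Euclidean space `ℝ^d`. -/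
abbrev E (d : ℕ) : Type := EuclideanSpace ℝ (Fin d)

/-- The second directional derivative `D²R(x)[h,h]`. -/
def hessQF {d : ℕ} (R : E d → ℝ) (x h : E d) : ℝ := iteratedFDeriv ℝ 2 R x ![h, h]

/-- `R` is a self-concordant function on `K`. -/
def IsSelfConcordant {d : ℕ} (K : Set (E d)) (R : E d → ℝ) : Prop :=
  ContDiffOn ℝ 3 R (interior K) ∧
  ConvexOn ℝ (interior K) R ∧
  (∀ (x : ℕ → E d) (p : E d), (∀ n, x n ∈ interior K) →
      Tendsto x atTop (𝓝 p) → p ∈ frontier K →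
      Tendsto (fun n => R (x n)) atTop atTop) ∧
  (∀ x ∈ interior K, ∀ h : E d,
      |iteratedFDeriv ℝ 3 R x ![h, h, h]| ≤ 2 * (hessQF R x h) ^ (3/2 : ℝ))

/-- `R` is a `ϑ`-self-concordant barrier on `K`. -/
def IsSelfConcordantBarrier {d : ℕ} (K : Set (E d)) (ϑ : ℝ) (R : E d → ℝ) : Prop :=
  IsSelfConcordant K R ∧
  ∀ x ∈ interior K, ∀ h : E d, |fderiv ℝ R x h| ≤ Real.sqrt (ϑ * hessQF R x h)

/-- The support function `φ_K(θ) = sup_{x ∈ K} ⟨x, θ⟩`. -/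
def suppFun {d : ℕ} (K : Set (E d)) (θ : E d) : ℝ := ⨆ x : K, ⟪(x : E d), θ⟫

/-- The Fenchel conjugate `R*(θ) = sup_{x ∈ int K} (⟨x,θ⟩ - R(x))`. -/
def conjOn {d : ℕ} (K : Set (E d)) (R : E d → ℝ) (θ : E d) : ℝ :=
  ⨆ x : interior K, (⟪(x : E d), θ⟫ - R x)

/-- The density on `ℝ^d` of the self-concordant perturbation for the Euclidean ball. -/
def fball (d : ℕ) (x : E d) : ℝ :=
  (Real.Gamma ((d : ℝ) + 1/2) / (2 * Real.pi ^ ((d : ℝ)/2) * Real.Gamma (((d : ℝ) + 1)/2))) *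
    ∫ t in (0:ℝ)..1, t ^ (((d : ℝ) - 1)/2) * (1 + t * ‖x‖^2) ^ (-(d : ℝ) - 1/2)

/-- The self-concordant perturbation for the Euclidean ball, as a measure on `ℝ^d`. -/
def ballPert (d : ℕ) : Measure (E d) :=
  volume.withDensity fun x => ENNReal.ofReal (fball d x)

/-- The closed unit Euclidean ball `𝔹^d`. -/
def ball (d : ℕ) : Set (E d) := Metric.closedBall (0 : E d) 1

/-- The logarithmic barrier `R(z) = −ln(1 − ‖z‖²)` on the unit ball. -/
def Rball (d : ℕ) (z : E d) : ℝ := -Real.log (1 - ‖z‖^2)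

section LogBarrier

theorem iteratedFDeriv_succ_apply_const_of_eventuallyEq {V : Type*} [NormedAddCommGroup V]
    [NormedSpace ℝ V] {f g : V → ℝ} {k : ℕ} {x h : V} {c : ℝ}
    (hf : DifferentiableAt ℝ (iteratedFDeriv ℝ k f) x)
    (hg : (fun z => iteratedFDeriv ℝ k f z (fun _ => h)) =ᶠ[𝓝 x] g)
    (hd : HasDerivAt (fun t : ℝ => g (x + t • h)) c 0) :
    iteratedFDeriv ℝ (k + 1) f x (fun _ => h) = c := by
  have hline : HasDerivAt (fun t : ℝ => x + t • h) h 0 := by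
    simpa using ((hasDerivAt_id (0 : ℝ)).smul_const h).const_add x
  have h1 : HasDerivAt (fun t : ℝ => iteratedFDeriv ℝ k f (x + t • h))
      (fderiv ℝ (iteratedFDeriv ℝ k f) x h) 0 := by
    have : HasFDerivAt (iteratedFDeriv ℝ k f) (fderiv ℝ (iteratedFDeriv ℝ k f) x)
        (x + (0 : ℝ) • h) := by
      simpa using hf.hasFDerivAt
    exact this.comp_hasDerivAt 0 hline
  have h2 := (ContinuousMultilinearMap.apply ℝ (fun _ : Fin k => V) ℝ
    (fun _ => h)).hasFDerivAt.comp_hasDerivAt 0 h1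
  have hcont : Tendsto (fun t : ℝ => x + t • h) (𝓝 0) (𝓝 x) := by
    simpa using hline.continuousAt.tendsto
  have hev : (fun t : ℝ => g (x + t • h)) =ᶠ[𝓝 0]
      fun t => iteratedFDeriv ℝ k f (x + t • h) fun _ => h :=
    (hcont.eventually hg).mono fun _ ht => ht.symm
  have h3 := h2.congr_of_eventuallyEq hev
  rw [iteratedFDeriv_succ_apply_left]
  exact h3.unique hd

theorem interior_ball (d : ℕ) : interior (ball d) = Metric.ball (0 : E d) 1 :=
  interior_closedBall _ one_ne_zero

theorem one_sub_norm_sq_pos {d : ℕ} {x : E d} (hx : x ∈ Metric.ball (0 : E d) 1) :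
    0 < 1 - ‖x‖ ^ 2 := by
  have : ‖x‖ < 1 := by simpa using hx
  nlinarith [norm_nonneg x]

theorem contDiffAt_Rball {d : ℕ} {n : WithTop ℕ∞} {x : E d}
    (hx : x ∈ Metric.ball (0 : E d) 1) : ContDiffAt ℝ n (Rball d) x := by
  have : ContDiffAt ℝ n (fun z : E d => 1 - ‖z‖ ^ 2) x :=
    contDiffAt_const.sub (contDiff_norm_sq ℝ).contDiffAt
  exact (this.log (one_sub_norm_sq_pos hx).ne').neg

theorem differentiableAt_iteratedFDeriv_Rball {d : ℕ} (k : ℕ) {x : E d}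
    (hx : x ∈ Metric.ball (0 : E d) 1) :
    DifferentiableAt ℝ (iteratedFDeriv ℝ k (Rball d)) x :=
  (contDiffAt_Rball (n := (⊤ : ℕ∞)) hx).differentiableAt_iteratedFDeriv
    (by exact_mod_cast ENat.natCast_lt_top k)

/-- The directional derivative `DR(x)[h]` of the logarithmic barrier. -/
def barrierSlope {d : ℕ} (h x : E d) : ℝ := 2 * ⟪x, h⟫ / (1 - ‖x‖ ^ 2)

/-- The isotropic part `2‖h‖² / (1 - ‖x‖²)` of the Hessian of the logarithmic barrier. -/
def barrierCurv {d : ℕ} (h x : E d) : ℝ := 2 * ‖h‖ ^ 2 / (1 - ‖x‖ ^ 2)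

theorem hasDerivAt_one_sub_norm_sq_line {d : ℕ} (x h : E d) :
    HasDerivAt (fun t : ℝ => 1 - ‖x + t • h‖ ^ 2) (-(2 * ⟪x, h⟫)) 0 := by
  have hline : HasDerivAt (fun t : ℝ => x + t • h) h 0 := by
    simpa using ((hasDerivAt_id (0 : ℝ)).smul_const h).const_add x
  have := hline.norm_sq.const_sub 1
  simpa using this

theorem hasDerivAt_Rball_line {d : ℕ} {x : E d} (h : E d)
    (hx : x ∈ Metric.ball (0 : E d) 1) :
    HasDerivAt (fun t : ℝ => Rball d (x + t • h)) (barrierSlope h x) 0 := by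
  have hw := (one_sub_norm_sq_pos hx).ne'
  have := ((hasDerivAt_one_sub_norm_sq_line x h).log (by simpa using hw)).neg
  convert! this using 1
  simp only [barrierSlope, zero_smul, add_zero]
  ring

theorem hasDerivAt_barrierCurv_line {d : ℕ} {x : E d} (h : E d)
    (hx : x ∈ Metric.ball (0 : E d) 1) :
    HasDerivAt (fun t : ℝ => barrierCurv h (x + t • h)) (barrierSlope h x * barrierCurv h x) 0 := by
  have hw := (one_sub_norm_sq_pos hx).ne'
  have := (hasDerivAt_const (0 : ℝ) (2 * ‖h‖ ^ 2)).div (hasDerivAt_one_sub_norm_sq_line x h)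
    (by simpa using hw)
  convert! this using 1
  simp only [barrierSlope, barrierCurv, zero_smul, add_zero]
  field_simp
  ring

theorem hasDerivAt_barrierSlope_line {d : ℕ} {x : E d} (h : E d)
    (hx : x ∈ Metric.ball (0 : E d) 1) :
    HasDerivAt (fun t : ℝ => barrierSlope h (x + t • h))
      (barrierCurv h x + barrierSlope h x ^ 2) 0 := by
  have hw := (one_sub_norm_sq_pos hx).ne'
  have hnum : HasDerivAt (fun t : ℝ => 2 * ⟪x + t • h, h⟫) (2 * ‖h‖ ^ 2) 0 := by
    have hline : HasDerivAt (fun t : ℝ => x + t • h) h 0 := by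
      simpa using ((hasDerivAt_id (0 : ℝ)).smul_const h).const_add x
    simpa using (hline.inner ℝ (hasDerivAt_const (0 : ℝ) h)).const_mul 2
  have := hnum.div (hasDerivAt_one_sub_norm_sq_line x h) (by simpa using hw)
  convert! this using 1
  simp only [barrierSlope, barrierCurv, zero_smul, add_zero]
  field_simp
  ring

theorem eventually_mem_unitBall {d : ℕ} {x : E d} (hx : x ∈ Metric.ball (0 : E d) 1) :
    ∀ᶠ z in 𝓝 x, z ∈ Metric.ball (0 : E d) 1 :=
  Metric.isOpen_ball.mem_nhds hx

theorem iteratedFDeriv_one_Rball {d : ℕ} {x : E d} (h : E d)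
    (hx : x ∈ Metric.ball (0 : E d) 1) :
    iteratedFDeriv ℝ 1 (Rball d) x (fun _ => h) = barrierSlope h x :=
  iteratedFDeriv_succ_apply_const_of_eventuallyEq
    (differentiableAt_iteratedFDeriv_Rball 0 hx) (Eventually.of_forall fun _ => by simp)
    (hasDerivAt_Rball_line h hx)

theorem iteratedFDeriv_two_Rball {d : ℕ} {x : E d} (h : E d)
    (hx : x ∈ Metric.ball (0 : E d) 1) :
    iteratedFDeriv ℝ 2 (Rball d) x (fun _ => h) = barrierCurv h x + barrierSlope h x ^ 2 :=
  iteratedFDeriv_succ_apply_const_of_eventuallyEq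
    (differentiableAt_iteratedFDeriv_Rball 1 hx)
    ((eventually_mem_unitBall hx).mono fun _ hz => iteratedFDeriv_one_Rball h hz)
    (hasDerivAt_barrierSlope_line h hx)

theorem iteratedFDeriv_three_Rball {d : ℕ} {x : E d} (h : E d)
    (hx : x ∈ Metric.ball (0 : E d) 1) :
    iteratedFDeriv ℝ 3 (Rball d) x (fun _ => h) =
      3 * barrierSlope h x * barrierCurv h x + 2 * barrierSlope h x ^ 3 := by
  refine iteratedFDeriv_succ_apply_const_of_eventuallyEq
    (differentiableAt_iteratedFDeriv_Rball 2 hx)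
    ((eventually_mem_unitBall hx).mono fun _ hz => iteratedFDeriv_two_Rball h hz) ?_
  have := (hasDerivAt_barrierCurv_line h hx).add ((hasDerivAt_barrierSlope_line h hx).pow 2)
  convert! this using 1
  simp only [zero_smul, add_zero, Nat.cast_ofNat]
  ring

theorem abs_le_two_mul_rpow_three_halves {a b : ℝ} (hb : 0 ≤ b) :
    |3 * a * b + 2 * a ^ 3| ≤ 2 * (b + a ^ 2) ^ (3 / 2 : ℝ) := by
  have hc : 0 ≤ b + a ^ 2 := by positivity
  refine abs_le_of_sq_le_sq ?_ (by positivity)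
  have : ((b + a ^ 2) ^ (3 / 2 : ℝ)) ^ 2 = (b + a ^ 2) ^ 3 := by
    rw [← Real.rpow_mul_natCast hc, ← Real.rpow_natCast]
    norm_num
  rw [mul_pow, this]
  have h1 : 0 ≤ b ^ 3 := by positivity
  have h2 : 0 ≤ a ^ 2 * b ^ 2 := by positivity
  nlinarith

theorem convexOn_Rball (d : ℕ) : ConvexOn ℝ (Metric.ball (0 : E d) 1) (Rball d) := by
  have hsq : ConvexOn ℝ (Metric.ball (0 : E d) 1) fun z : E d => ‖z‖ ^ 2 :=
    (convexOn_norm (convex_ball _ _)).pow (fun _ _ => norm_nonneg _) 2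
  refine ⟨convex_ball _ _, fun x hx y hy a b ha hb hab => ?_⟩
  have hz := (convex_ball (0 : E d) 1) hx hy ha hb hab
  have h1 := hsq.2 hx hy ha hb hab
  have h2 := strictConcaveOn_log_Ioi.concaveOn.2 (one_sub_norm_sq_pos hx)
    (one_sub_norm_sq_pos hy) ha hb hab
  have hpos : 0 < a • (1 - ‖x‖ ^ 2) + b • (1 - ‖y‖ ^ 2) :=
    (convex_Ioi (0 : ℝ)) (one_sub_norm_sq_pos hx) (one_sub_norm_sq_pos hy) ha hb hab
  have h3 : Real.log (a • (1 - ‖x‖ ^ 2) + b • (1 - ‖y‖ ^ 2)) ≤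
      Real.log (1 - ‖a • x + b • y‖ ^ 2) := by
    refine Real.log_le_log hpos ?_
    simp only [smul_eq_mul] at h1 ⊢
    linarith
  simp only [Rball, smul_eq_mul] at h1 h2 h3 ⊢
  linarith

theorem isSelfConcordantBarrier_Rball (d : ℕ) :
    IsSelfConcordantBarrier (ball d) 1 (Rball d) := by
  have hvec2 (h : E d) : ![h, h] = fun _ => h := by ext i; fin_cases i <;> rfl
  have hvec3 (h : E d) : ![h, h, h] = fun _ => h := by ext i; fin_cases i <;> rfl
  have hcurv {x : E d} (h : E d) (hx : x ∈ Metric.ball (0 : E d) 1) : 0 ≤ barrierCurv h x := by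
    have := one_sub_norm_sq_pos hx
    unfold barrierCurv
    positivity
  refine ⟨⟨?_, ?_, ?_, ?_⟩, ?_⟩
  · rw [interior_ball]
    exact fun x hx => (contDiffAt_Rball hx).contDiffWithinAt
  · rw [interior_ball]
    exact convexOn_Rball d
  · intro x p hx hp hpf
    rw [interior_ball] at hx
    have hp1 : ‖p‖ = 1 := by
      rw [ball, frontier_closedBall _ one_ne_zero] at hpf
      simpa using hpf
    have h0 : Tendsto (fun n => 1 - ‖x n‖ ^ 2) atTop (𝓝[>] 0) := by
      refine tendsto_nhdsWithin_iff.2 ⟨?_, Eventually.of_forall fun n => one_sub_norm_sq_pos (hx n)⟩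
      have := (hp.norm.pow 2).const_sub 1
      simpa [hp1] using this
    exact tendsto_neg_atBot_atTop.comp (Real.tendsto_log_nhdsGT_zero.comp h0)
  · intro x hx h
    rw [interior_ball] at hx
    rw [hessQF, hvec3, hvec2, iteratedFDeriv_two_Rball h hx, iteratedFDeriv_three_Rball h hx]
    exact abs_le_two_mul_rpow_three_halves (hcurv h hx)
  · intro x hx h
    rw [interior_ball] at hx
    have h1 : fderiv ℝ (Rball d) x h = barrierSlope h x := by
      rw [← iteratedFDeriv_one_Rball h hx, iteratedFDeriv_one_apply]
    rw [hessQF, hvec2, iteratedFDeriv_two_Rball h hx, h1, one_mul]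
    refine Real.abs_le_sqrt ?_
    linarith [hcurv h hx]

end LogBarrier

section Conjugate

theorem one_add_sqrt_pos {d : ℕ} (θ : E d) : 0 < 1 + √(1 + ‖θ‖ ^ 2) := by positivity

theorem suppFun_ball {d : ℕ} (θ : E d) : suppFun (ball d) θ = ‖θ‖ := by
  have hbound : ∀ x : ball d, ⟪(x : E d), θ⟫ ≤ ‖θ‖ := fun x => by
    have hx : ‖(x : E d)‖ ≤ 1 := by simpa [ball] using x.2
    exact (real_inner_le_norm _ _).trans (mul_le_of_le_one_left (norm_nonneg _) hx)
  have : Nonempty (ball d) := ⟨⟨0, by simp [ball]⟩⟩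
  refine le_antisymm (ciSup_le hbound) ?_
  rcases eq_or_ne θ 0 with rfl | hθ
  · simp [suppFun]
  · have hn : ‖θ‖ ≠ 0 := norm_ne_zero_iff.2 hθ
    have := le_ciSup (f := fun x : ball d => ⟪(x : E d), θ⟫)
      ⟨_, Set.forall_mem_range.2 hbound⟩ ⟨‖θ‖⁻¹ • θ, by simp [ball, norm_smul, hn]⟩
    refine le_of_eq_of_le ?_ this
    simp only [real_inner_smul_left, real_inner_self_eq_norm_sq]
    field_simp

theorem gradient_suppFun_ball {d : ℕ} {θ : E d} (hθ : θ ≠ 0) :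
    gradient (suppFun (ball d)) θ = ‖θ‖⁻¹ • θ := by
  have hn : ‖θ‖ ≠ 0 := norm_ne_zero_iff.2 hθ
  refine HasGradientAt.gradient ?_
  rw [hasGradientAt_iff_hasFDerivAt]
  have h1 := (hasStrictFDerivAt_norm_sq θ).hasFDerivAt.sqrt (pow_ne_zero 2 hn)
  have h2 : (fun x : E d => √(‖x‖ ^ 2)) = suppFun (ball d) := by
    ext x
    rw [suppFun_ball, Real.sqrt_sq (norm_nonneg x)]
  rw [h2, Real.sqrt_sq (norm_nonneg θ)] at h1
  convert! h1 using 1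
  ext y
  simp
  field_simp

/-- The maximiser of `x ↦ ⟨x, θ⟩ - R(x)` over the unit ball. -/
def conjArgmax {d : ℕ} (θ : E d) : E d := (1 + √(1 + ‖θ‖ ^ 2))⁻¹ • θ

theorem one_sub_norm_sq_conjArgmax {d : ℕ} (θ : E d) :
    1 - ‖conjArgmax θ‖ ^ 2 = 2 / (1 + √(1 + ‖θ‖ ^ 2)) := by
  have hq := one_add_sqrt_pos θ
  have hs : √(1 + ‖θ‖ ^ 2) ^ 2 = 1 + ‖θ‖ ^ 2 := Real.sq_sqrt (by positivity)
  rw [conjArgmax, norm_smul, norm_inv, Real.norm_of_nonneg hq.le]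
  field_simp
  nlinarith

theorem inner_sub_Rball_le {d : ℕ} (θ x : E d) (hx : x ∈ Metric.ball (0 : E d) 1) :
    ⟪x, θ⟫ - Rball d x ≤ ⟪conjArgmax θ, θ⟫ - Rball d (conjArgmax θ) := by
  have hq := one_add_sqrt_pos θ
  set q := 1 + √(1 + ‖θ‖ ^ 2) with hqdef
  set x₀ := conjArgmax θ with hx₀
  have hθ : θ = q • x₀ := by
    rw [hx₀, conjArgmax, smul_smul, mul_inv_cancel₀ hq.ne', one_smul]
  have hw0 : 1 - ‖x₀‖ ^ 2 = 2 / q := one_sub_norm_sq_conjArgmax θ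
  have hw := one_sub_norm_sq_pos hx
  have hlog : Real.log (1 - ‖x‖ ^ 2) - Real.log (2 / q) ≤ (1 - ‖x‖ ^ 2) / (2 / q) - 1 := by
    rw [← Real.log_div hw.ne' (by positivity)]
    exact Real.log_le_sub_one_of_pos (by positivity)
  have hdiv : (1 - ‖x‖ ^ 2) / (2 / q) - 1 = q / 2 * (‖x₀‖ ^ 2 - ‖x‖ ^ 2) := by
    have : ‖x₀‖ ^ 2 = 1 - 2 / q := by linarith
    rw [this]
    field_simp
    ring
  have hsq : 0 ≤ q / 2 * (‖x‖ ^ 2 - 2 * ⟪x, x₀⟫ + ‖x₀‖ ^ 2) := by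
    rw [← norm_sub_sq_real]
    positivity
  have e1 : ⟪x, θ⟫ = q * ⟪x, x₀⟫ := by rw [hθ, real_inner_smul_right]
  have e2 : ⟪x₀, θ⟫ = q * ‖x₀‖ ^ 2 := by
    rw [hθ, real_inner_smul_right, real_inner_self_eq_norm_sq]
  rw [e1, e2, Rball, Rball, hw0]
  nlinarith

theorem conjOn_Rball {d : ℕ} (θ : E d) :
    conjOn (ball d) (Rball d) θ =
      √(1 + ‖θ‖ ^ 2) - 1 + Real.log 2 - Real.log (1 + √(1 + ‖θ‖ ^ 2)) := by
  have hq := one_add_sqrt_pos θ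
  have hs : √(1 + ‖θ‖ ^ 2) ^ 2 = 1 + ‖θ‖ ^ 2 := Real.sq_sqrt (by positivity)
  have hmem : conjArgmax θ ∈ interior (ball d) := by
    rw [interior_ball, mem_ball_zero_iff]
    have : 0 < 1 - ‖conjArgmax θ‖ ^ 2 := by
      rw [one_sub_norm_sq_conjArgmax]
      positivity
    nlinarith [norm_nonneg (conjArgmax θ)]
  have hbound : ∀ x : interior (ball d),
      ⟪(x : E d), θ⟫ - Rball d x ≤ ⟪conjArgmax θ, θ⟫ - Rball d (conjArgmax θ) :=
    fun x => inner_sub_Rball_le θ x (by rw [← interior_ball]; exact x.2)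
  have : Nonempty (interior (ball d)) := ⟨⟨_, hmem⟩⟩
  have hsup : conjOn (ball d) (Rball d) θ =
      ⟪conjArgmax θ, θ⟫ - Rball d (conjArgmax θ) :=
    le_antisymm (ciSup_le hbound)
      (le_ciSup (f := fun x : interior (ball d) => ⟪(x : E d), θ⟫ - Rball d x)
        ⟨_, Set.forall_mem_range.2 hbound⟩ ⟨_, hmem⟩)
  rw [hsup, Rball, one_sub_norm_sq_conjArgmax, Real.log_div two_ne_zero hq.ne', conjArgmax,
    real_inner_smul_left, real_inner_self_eq_norm_sq]
  have : (1 + √(1 + ‖θ‖ ^ 2))⁻¹ * ‖θ‖ ^ 2 = √(1 + ‖θ‖ ^ 2) - 1 := by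
    field_simp
    nlinarith
  rw [this]
  ring

theorem gradient_conjOn_Rball {d : ℕ} (θ : E d) :
    gradient (conjOn (ball d) (Rball d)) θ = (1 + √(1 + ‖θ‖ ^ 2))⁻¹ • θ := by
  have hq := one_add_sqrt_pos θ
  have hp : 0 < √(1 + ‖θ‖ ^ 2) := by positivity
  refine HasGradientAt.gradient ?_
  rw [hasGradientAt_iff_hasFDerivAt, funext conjOn_Rball]
  have h1 := ((hasStrictFDerivAt_norm_sq θ).hasFDerivAt.const_add 1).sqrt
    (by positivity : (1 : ℝ) + ‖θ‖ ^ 2 ≠ 0)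
  have h2 := ((h1.sub_const 1).add_const (Real.log 2)).sub ((h1.const_add 1).log hq.ne')
  convert! h2 using 1
  ext y
  simp
  field_simp
  ring

theorem sqrt_sub_one_div_norm_sq {d : ℕ} {θ : E d} (hθ : θ ≠ 0) :
    (√(1 + ‖θ‖ ^ 2) - 1) / ‖θ‖ ^ 2 = (1 + √(1 + ‖θ‖ ^ 2))⁻¹ := by
  have hq := one_add_sqrt_pos θ
  have hn : ‖θ‖ ≠ 0 := norm_ne_zero_iff.2 hθ
  have hs : √(1 + ‖θ‖ ^ 2) ^ 2 = 1 + ‖θ‖ ^ 2 := Real.sq_sqrt (by positivity)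
  field_simp
  nlinarith

end Conjugate

section StudentIntegrals

theorem add_mul_norm_sq_rpow_neg {V : Type*} [NormedAddCommGroup V] [InnerProductSpace ℝ V]
    {A B : ℝ} (hA : 0 < A) (hB : 0 < B) (a : ℝ) (y : V) :
    (A + B * ‖y‖ ^ 2) ^ (-a) = A ^ (-a) * (1 + ‖√(B / A) • y‖ ^ 2) ^ (-a) := by
  rw [norm_smul, mul_pow, Real.norm_of_nonneg (Real.sqrt_nonneg _),
    Real.sq_sqrt (by positivity), ← Real.mul_rpow hA.le (by positivity)]
  congr 1
  field_simp

variable {V : Type*} [NormedAddCommGroup V] [InnerProductSpace ℝ V] [FiniteDimensional ℝ V]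
  [MeasurableSpace V] [BorelSpace V]

theorem integrable_one_add_norm_sq_rpow_neg {a : ℝ} (ha : (Module.finrank ℝ V : ℝ) / 2 < a) :
    Integrable fun y : V => (1 + ‖y‖ ^ 2) ^ (-a) := by
  have := integrable_rpow_neg_one_add_norm_sq (E := V) (μ := volume) (r := 2 * a) (by linarith)
  convert! this using 3
  ring

theorem integrable_add_mul_norm_sq_rpow_neg {A B a : ℝ} (hA : 0 < A) (hB : 0 < B)
    (ha : (Module.finrank ℝ V : ℝ) / 2 < a) :
    Integrable fun y : V => (A + B * ‖y‖ ^ 2) ^ (-a) := by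
  simp_rw [add_mul_norm_sq_rpow_neg hA hB a]
  exact ((integrable_one_add_norm_sq_rpow_neg ha).comp_smul
    (Real.sqrt_pos.2 (div_pos hB hA)).ne').const_mul _

theorem integral_one_add_norm_sq_rpow_neg {a : ℝ} (ha : (Module.finrank ℝ V : ℝ) / 2 < a) :
    ∫ y : V, (1 + ‖y‖ ^ 2) ^ (-a) =
      π ^ ((Module.finrank ℝ V : ℝ) / 2) * Real.Gamma (a - (Module.finrank ℝ V : ℝ) / 2) /
        Real.Gamma a := by
  set n : ℝ := (Module.finrank ℝ V : ℝ) with hn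
  have hn0 : 0 ≤ n := Nat.cast_nonneg _
  have ha0 : 0 < a := by linarith
  have hG : 0 < Real.Gamma a := Real.Gamma_pos_of_pos ha0
  let F : V → ℝ → ℝ := fun y s => s ^ (a - 1) * Real.exp (-((1 + ‖y‖ ^ 2) * s))
  have hinner (y : V) : ∫ s in Set.Ioi (0 : ℝ), F y s =
      (1 + ‖y‖ ^ 2) ^ (-a) * Real.Gamma a := by
    have h0 : 0 < 1 + ‖y‖ ^ 2 := by positivity
    rw [Real.integral_rpow_mul_exp_neg_mul_Ioi ha0 h0, one_div, Real.inv_rpow h0.le,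
      Real.rpow_neg h0.le]
  have hmeas : AEStronglyMeasurable (Function.uncurry F)
      (volume.prod (volume.restrict (Set.Ioi (0 : ℝ)))) := by
    apply Measurable.aestronglyMeasurable
    unfold F
    fun_prop
  have hint : Integrable (Function.uncurry F)
      (volume.prod (volume.restrict (Set.Ioi (0 : ℝ)))) := by
    refine (integrable_prod_iff hmeas).2 ⟨Eventually.of_forall fun y => ?_, ?_⟩
    · refine not_imp_comm.1 (integral_undef (f := F y)) ?_
      rw [hinner]
      positivity
    · have : (fun y : V => ∫ s in Set.Ioi (0 : ℝ), ‖Function.uncurry F (y, s)‖) =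
          fun y => (1 + ‖y‖ ^ 2) ^ (-a) * Real.Gamma a := by
        ext y
        rw [← hinner]
        refine setIntegral_congr_fun measurableSet_Ioi fun s hs => ?_
        have hs : 0 < s := hs
        exact Real.norm_of_nonneg (by simp only [Function.uncurry, F]; positivity)
      rw [this]
      exact (integrable_one_add_norm_sq_rpow_neg ha).mul_const _
  have hswap := integral_integral_swap hint
  simp_rw [hinner] at hswap
  rw [integral_mul_const] at hswap
  rw [eq_div_iff hG.ne', hswap]
  have hgauss : ∀ s ∈ Set.Ioi (0 : ℝ),
      ∫ y : V, F y s = π ^ (n / 2) * (s ^ (a - n / 2 - 1) * Real.exp (-(1 * s))) := by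
    intro s hs
    have hs : 0 < s := hs
    have : ∀ y : V, F y s =
        s ^ (a - 1) * Real.exp (-s) * Real.exp (-s * ‖y‖ ^ 2) := fun y => by
      rw [mul_assoc, ← Real.exp_add]
      simp only [F]
      congr 2
      ring
    simp_rw [this]
    rw [integral_const_mul, GaussianFourier.integral_rexp_neg_mul_sq_norm hs,
      Real.div_rpow Real.pi_pos.le hs.le, ← hn,
      show a - n / 2 - 1 = (a - 1) - n / 2 by ring, Real.rpow_sub hs (a - 1), one_mul]
    ring
  rw [setIntegral_congr_fun measurableSet_Ioi hgauss, integral_const_mul,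
    Real.integral_rpow_mul_exp_neg_mul_Ioi (by linarith) one_pos]
  simp

theorem integral_add_mul_norm_sq_rpow_neg {A B a : ℝ} (hA : 0 < A) (hB : 0 < B)
    (ha : (Module.finrank ℝ V : ℝ) / 2 < a) :
    ∫ y : V, (A + B * ‖y‖ ^ 2) ^ (-a) =
      A ^ ((Module.finrank ℝ V : ℝ) / 2 - a) * B ^ (-((Module.finrank ℝ V : ℝ) / 2)) *
        (π ^ ((Module.finrank ℝ V : ℝ) / 2) *
          Real.Gamma (a - (Module.finrank ℝ V : ℝ) / 2) / Real.Gamma a) := by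
  have hBA : 0 < B / A := div_pos hB hA
  simp_rw [add_mul_norm_sq_rpow_neg hA hB a]
  rw [integral_const_mul,
    Measure.integral_comp_smul volume (fun y : V => (1 + ‖y‖ ^ 2) ^ (-a)),
    integral_one_add_norm_sq_rpow_neg ha, smul_eq_mul, ← mul_assoc, abs_of_nonneg (by positivity)]
  congr 1
  rw [Real.sqrt_eq_rpow, ← Real.rpow_mul_natCast hBA.le, ← Real.rpow_neg hBA.le,
    Real.div_rpow hB.le hA.le, sub_eq_add_neg, add_comm, Real.rpow_add hA,
    show -(1 / 2 * (Module.finrank ℝ V : ℝ)) = -((Module.finrank ℝ V : ℝ) / 2) by ring,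
    Real.rpow_neg hA.le ((Module.finrank ℝ V : ℝ) / 2)]
  field_simp

end StudentIntegrals

section StudentDirection

theorem integral_smul_self_eq_zero_of_even {V : Type*} [NormedAddCommGroup V] [NormedSpace ℝ V]
    [MeasurableSpace V] [BorelSpace V] {μ : Measure V} [μ.IsNegInvariant] {g : V → ℝ}
    (hg : ∀ y, g (-y) = g y) : ∫ y, g y • y ∂μ = 0 := by
  have h := integral_neg_eq_self (fun y => g y • y) μ
  simp_rw [hg, smul_neg, integral_neg] at h
  have h2 : (2 : ℝ) • ∫ y, g y • y ∂μ = 0 := by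
    rw [two_smul]
    nth_rewrite 1 [← h]
    exact neg_add_cancel _
  exact (smul_eq_zero.1 h2).resolve_left two_ne_zero

theorem integrable_add_mul_norm_sq_rpow_neg_smul_self {V : Type*} [NormedAddCommGroup V]
    [InnerProductSpace ℝ V] [FiniteDimensional ℝ V] [MeasurableSpace V] [BorelSpace V]
    {A B a : ℝ} (hA : 0 < A) (hB : 1 ≤ B) (ha : (Module.finrank ℝ V : ℝ) / 2 < a) :
    Integrable fun y : V => (A + B * ‖y‖ ^ 2) ^ (-(a + 1 / 2)) • y := by
  refine (integrable_add_mul_norm_sq_rpow_neg hA (one_pos.trans_le hB) ha).mono' ?_ ?_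
  · apply Measurable.aestronglyMeasurable
    fun_prop
  · refine Eventually.of_forall fun y => ?_
    have hpos : 0 < A + B * ‖y‖ ^ 2 := by positivity
    have hy : ‖y‖ ≤ (A + B * ‖y‖ ^ 2) ^ (1 / 2 : ℝ) := by
      rw [← Real.sqrt_eq_rpow]
      exact Real.le_sqrt_of_sq_le (by nlinarith [sq_nonneg ‖y‖])
    rw [norm_smul, Real.norm_of_nonneg (by positivity), neg_add, Real.rpow_add hpos,
      Real.rpow_neg hpos.le (1 / 2), mul_assoc]
    refine mul_le_of_le_one_right (by positivity) ?_
    rw [inv_mul_le_one₀ (by positivity)]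
    exact hy

variable {d : ℕ}

theorem finrank_E : (Module.finrank ℝ (E d) : ℝ) = d := by simp

/-- The direction `w / ‖w‖` of a vector, with value `0` at `0`. -/
def direction (w : E d) : E d := ‖w‖⁻¹ • w

theorem norm_direction_le_one (w : E d) : ‖direction w‖ ≤ 1 := by
  rw [direction, norm_smul, norm_inv, norm_norm]
  exact inv_mul_le_one

theorem measurable_direction : Measurable (direction (d := d)) := by
  unfold direction
  fun_prop

theorem direction_smul {c : ℝ} (hc : 0 < c) (w : E d) : direction (c • w) = direction w := by
  rw [direction, direction, norm_smul, Real.norm_of_nonneg hc.le, smul_smul]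
  congr 1
  field_simp

/-- The total mass of `y ↦ (1 + ‖y‖²) ^ (-(d + 1/2))` on `ℝ^d`. -/
def studentMass (d : ℕ) : ℝ :=
  π ^ ((d : ℝ) / 2) * Real.Gamma (((d : ℝ) + 1) / 2) / Real.Gamma ((d : ℝ) + 1 / 2)

theorem integral_line_kernel {A B : ℝ} (hA : 0 < A) (hB : 0 < B) {a : ℝ} (ha : 1 / 2 < a) :
    ∫ σ : ℝ, (A + B * ‖σ‖ ^ 2) ^ (-a) =
      A ^ (1 / 2 - a) * (√B)⁻¹ * (√π * Real.Gamma (a - 1 / 2) / Real.Gamma a) := by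
  have := integral_add_mul_norm_sq_rpow_neg (V := ℝ) hA hB (a := a) (by simpa using ha)
  simpa [Real.sqrt_eq_rpow, Real.rpow_neg hB.le] using this

theorem integral_space_kernel_smul (σ : ℝ) (v : E d) :
    ∫ w : E d, (1 + ‖w - v‖ ^ 2 + ‖w‖ ^ 2 * ‖σ‖ ^ 2) ^ (-((d : ℝ) + 1)) • w =
      ((1 + (1 + ‖v‖ ^ 2) * ‖σ‖ ^ 2) ^ (-((d : ℝ) / 2 + 1)) *
        (π ^ ((d : ℝ) / 2) * Real.Gamma ((d : ℝ) / 2 + 1) / Real.Gamma ((d : ℝ) + 1))) • v := by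
  set B : ℝ := 1 + ‖σ‖ ^ 2 with hBdef
  set N : ℝ := 1 + (1 + ‖v‖ ^ 2) * ‖σ‖ ^ 2 with hNdef
  have hB1 : 1 ≤ B := le_add_of_nonneg_right (sq_nonneg _)
  have hB : 0 < B := by positivity
  have hN : 0 < N := by positivity
  have hd0 : (0 : ℝ) ≤ d := Nat.cast_nonneg d
  have hcomplete (y : E d) : 1 + ‖y + B⁻¹ • v - v‖ ^ 2 + ‖y + B⁻¹ • v‖ ^ 2 * ‖σ‖ ^ 2 =
      N / B + B * ‖y‖ ^ 2 := by
    have hσ : ‖σ‖ ^ 2 = B - 1 := by rw [hBdef]; ring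
    rw [hNdef, norm_sub_sq_real, norm_add_sq_real, inner_add_left, real_inner_smul_right,
      real_inner_smul_left, real_inner_self_eq_norm_sq, norm_smul, norm_inv,
      Real.norm_of_nonneg hB.le, hσ]
    field_simp
    ring
  rw [← integral_add_right_eq_self _ (B⁻¹ • v)]
  simp_rw [hcomplete, smul_add]
  have hfin : (Module.finrank ℝ (E d) : ℝ) / 2 < (d : ℝ) + 1 / 2 := by rw [finrank_E]; linarith
  have hfin' : (Module.finrank ℝ (E d) : ℝ) / 2 < (d : ℝ) + 1 := by linarith
  have hi := integrable_add_mul_norm_sq_rpow_neg_smul_self (V := E d) (div_pos hN hB) hB1 hfin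
  rw [show (d : ℝ) + 1 / 2 + 1 / 2 = d + 1 by ring] at hi
  rw [integral_add hi
      ((integrable_add_mul_norm_sq_rpow_neg (div_pos hN hB) hB hfin').smul_const _),
    integral_smul_self_eq_zero_of_even (fun y => by rw [norm_neg]), zero_add,
    integral_smul_const, integral_add_mul_norm_sq_rpow_neg (div_pos hN hB) hB hfin', finrank_E,
    smul_smul, show (d : ℝ) + 1 - d / 2 = d / 2 + 1 by ring,
    show (d : ℝ) / 2 - (d + 1) = -(d / 2 + 1) by ring]
  congr 1
  rw [Real.div_rpow hN.le hB.le, neg_add ((d : ℝ) / 2) 1, Real.rpow_add hB, Real.rpow_neg_one]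
  have := (Real.rpow_pos_of_pos hB (-((d : ℝ) / 2))).ne'
  field_simp

theorem integral_line_kernel_smul {v w : E d} (hw : w ≠ 0) :
    ∫ σ : ℝ, (1 + ‖w - v‖ ^ 2 + ‖w‖ ^ 2 * ‖σ‖ ^ 2) ^ (-((d : ℝ) + 1)) • w =
      (√π * Real.Gamma ((d : ℝ) + 1 / 2) / Real.Gamma ((d : ℝ) + 1)) •
        ((1 + ‖w - v‖ ^ 2) ^ (-((d : ℝ) + 1 / 2)) • direction w) := by
  have hn : 0 < ‖w‖ := norm_pos_iff.2 hw
  rw [integral_smul_const, integral_line_kernel (by positivity) (by positivity)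
    (by linarith [Nat.cast_nonneg (α := ℝ) d]), Real.sqrt_sq hn.le, direction, smul_smul, smul_smul,
    show (d : ℝ) + 1 - 1 / 2 = d + 1 / 2 by ring,
    show (1 : ℝ) / 2 - (d + 1) = -(d + 1 / 2) by ring]
  congr 1
  ring

theorem ae_ne_zero (hd : d ≠ 0) : ∀ᵐ w : E d, w ≠ 0 := by
  have : Nonempty (Fin d) := ⟨⟨0, Nat.pos_of_ne_zero hd⟩⟩
  exact compl_mem_ae_iff.2 (measure_singleton 0)

theorem integrable_studentKernel :
    Integrable fun y : E d => (1 + ‖y‖ ^ 2) ^ (-((d : ℝ) + 1 / 2)) :=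
  integrable_one_add_norm_sq_rpow_neg
    (by rw [finrank_E]; linarith [Nat.cast_nonneg (α := ℝ) d])

theorem integrable_uncurry_kernel_smul (hd : d ≠ 0) (v : E d) :
    Integrable (Function.uncurry fun (w : E d) (σ : ℝ) =>
      (1 + ‖w - v‖ ^ 2 + ‖w‖ ^ 2 * ‖σ‖ ^ 2) ^ (-((d : ℝ) + 1)) • w) := by
  have hd0 : (0 : ℝ) ≤ d := Nat.cast_nonneg d
  have hmeas : AEStronglyMeasurable (Function.uncurry fun (w : E d) (σ : ℝ) =>
      (1 + ‖w - v‖ ^ 2 + ‖w‖ ^ 2 * ‖σ‖ ^ 2) ^ (-((d : ℝ) + 1)) • w)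
      ((volume : Measure (E d)).prod (volume : Measure ℝ)) := by
    apply Measurable.aestronglyMeasurable
    unfold Function.uncurry
    fun_prop
  refine (integrable_prod_iff hmeas).2 ⟨?_, ?_⟩
  · filter_upwards [ae_ne_zero hd] with w hw
    have hn : 0 < ‖w‖ := norm_pos_iff.2 hw
    have hA : 0 < 1 + ‖w - v‖ ^ 2 := by positivity
    have hB : 0 < ‖w‖ ^ 2 := by positivity
    have ha : (Module.finrank ℝ ℝ : ℝ) / 2 < (d : ℝ) + 1 := by
      rw [Module.finrank_self, Nat.cast_one]
      linarith
    have := (integrable_add_mul_norm_sq_rpow_neg (V := ℝ) hA hB ha).smul_const w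
    simpa only [Function.uncurry] using this
  · refine ((integrable_studentKernel.comp_sub_right v).const_mul
      (√π * Real.Gamma ((d : ℝ) + 1 / 2) / Real.Gamma ((d : ℝ) + 1))).congr ?_
    filter_upwards [ae_ne_zero hd] with w hw
    have hn : 0 < ‖w‖ := norm_pos_iff.2 hw
    have hnorm (σ : ℝ) :
        ‖(1 + ‖w - v‖ ^ 2 + ‖w‖ ^ 2 * ‖σ‖ ^ 2) ^ (-((d : ℝ) + 1)) • w‖ =
          (1 + ‖w - v‖ ^ 2 + ‖w‖ ^ 2 * ‖σ‖ ^ 2) ^ (-((d : ℝ) + 1)) * ‖w‖ := by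
      rw [norm_smul, Real.norm_of_nonneg (by positivity)]
    simp only [Function.uncurry, hnorm]
    rw [integral_mul_const, integral_line_kernel (by positivity) (by positivity) (by linarith),
      Real.sqrt_sq hn.le, show (d : ℝ) + 1 - 1 / 2 = d + 1 / 2 by ring,
      show (1 : ℝ) / 2 - (d + 1) = -(d + 1 / 2) by ring]
    field_simp

theorem integral_studentKernel_smul_direction (hd : d ≠ 0) (v : E d) :
    ∫ y : E d, (1 + ‖y‖ ^ 2) ^ (-((d : ℝ) + 1 / 2)) • direction (v + y) =
      (studentMass d * (√(1 + ‖v‖ ^ 2))⁻¹) • v := by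
  have hd0 : (0 : ℝ) ≤ d := Nat.cast_nonneg d
  have hswap := integral_integral_swap (integrable_uncurry_kernel_smul hd v)
  simp_rw [integral_space_kernel_smul] at hswap
  rw [integral_congr_ae ((ae_ne_zero hd).mono fun w hw => integral_line_kernel_smul hw),
    integral_smul, integral_smul_const, integral_mul_const,
    integral_line_kernel one_pos (by positivity) (by linarith), Real.one_rpow, one_mul,
    show (d : ℝ) / 2 + 1 - 1 / 2 = (d + 1) / 2 by ring] at hswap
  have h1 : Real.Gamma ((d : ℝ) + 1 / 2) ≠ 0 := (Real.Gamma_pos_of_pos (by linarith)).ne'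
  have h2 : Real.Gamma ((d : ℝ) + 1) ≠ 0 := (Real.Gamma_pos_of_pos (by linarith)).ne'
  have h3 : Real.Gamma ((d : ℝ) / 2 + 1) ≠ 0 := (Real.Gamma_pos_of_pos (by linarith)).ne'
  have h4 : √π ≠ 0 := (Real.sqrt_pos.2 Real.pi_pos).ne'
  have hβ : √π * Real.Gamma ((d : ℝ) + 1 / 2) / Real.Gamma ((d : ℝ) + 1) ≠ 0 := by positivity
  rw [← integral_sub_right_eq_self _ v]
  simp only [add_sub_cancel]
  refine smul_right_injective _ hβ ?_
  simp only [hswap, smul_smul, studentMass]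
  congr 1
  field_simp

theorem integral_scaled_studentKernel_smul_direction (hd : d ≠ 0) (θ : E d) {t : ℝ} (ht : 0 < t) :
    ∫ x : E d, (t ^ (((d : ℝ) - 1) / 2) * (1 + t * ‖x‖ ^ 2) ^ (-(d : ℝ) - 1 / 2)) •
        direction (θ + x) =
      (studentMass d * (√(1 + t * ‖θ‖ ^ 2))⁻¹) • θ := by
  have hst : 0 < √t := Real.sqrt_pos.2 ht
  have hsq : √t ^ 2 = t := Real.sq_sqrt ht.le
  have h1 := Measure.integral_comp_smul (volume : Measure (E d))
    (fun y : E d => (1 + ‖y‖ ^ 2) ^ (-((d : ℝ) + 1 / 2)) • direction (√t • θ + y)) √t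
  simp_rw [integral_studentKernel_smul_direction hd, ← smul_add, direction_smul hst, norm_smul,
    mul_pow, Real.norm_of_nonneg hst.le, hsq] at h1
  simp_rw [mul_smul, show -(d : ℝ) - 1 / 2 = -(d + 1 / 2) by ring]
  rw [integral_smul, h1, smul_smul, smul_smul, smul_smul, smul_smul]
  congr 1
  have h2 : t ^ (((d : ℝ) - 1) / 2) * √t = √t ^ d := by
    rw [Real.sqrt_eq_rpow, ← Real.rpow_mul_natCast ht.le, ← Real.rpow_add ht]
    congr 1
    ring
  rw [finrank_euclideanSpace_fin, abs_of_nonneg (by positivity)]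
  calc _ = (t ^ (((d : ℝ) - 1) / 2) * √t) * (√t ^ d)⁻¹ *
        (studentMass d * (√(1 + t * ‖θ‖ ^ 2))⁻¹) := by ring
    _ = _ := by rw [h2, mul_inv_cancel₀ (by positivity), one_mul]

end StudentDirection

section BallPerturbation

variable {d : ℕ}

/-- The integrand in the mixture representation of `fball`. -/
def mixtureKernel (d : ℕ) (x : E d) (t : ℝ) : ℝ :=
  t ^ (((d : ℝ) - 1) / 2) * (1 + t * ‖x‖ ^ 2) ^ (-(d : ℝ) - 1 / 2)

/-- The normalising constant of `fball`. -/
def fballConst (d : ℕ) : ℝ :=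
  Real.Gamma ((d : ℝ) + 1 / 2) / (2 * π ^ ((d : ℝ) / 2) * Real.Gamma (((d : ℝ) + 1) / 2))

theorem fball_eq_setIntegral (x : E d) :
    fball d x = fballConst d * ∫ t in Set.Ioc (0 : ℝ) 1, mixtureKernel d x t := by
  rw [fball, intervalIntegral.integral_of_le zero_le_one]
  rfl

theorem fballConst_mul_studentMass (d : ℕ) : fballConst d * studentMass d = 1 / 2 := by
  have hd0 : (0 : ℝ) ≤ d := Nat.cast_nonneg d
  have h1 : Real.Gamma ((d : ℝ) + 1 / 2) ≠ 0 := (Real.Gamma_pos_of_pos (by linarith)).ne'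
  have h2 : Real.Gamma (((d : ℝ) + 1) / 2) ≠ 0 := (Real.Gamma_pos_of_pos (by linarith)).ne'
  have h3 : π ^ ((d : ℝ) / 2) ≠ 0 := (Real.rpow_pos_of_pos Real.pi_pos _).ne'
  rw [fballConst, studentMass]
  field_simp

theorem measurable_uncurry_mixtureKernel :
    Measurable (Function.uncurry (mixtureKernel d)) := by
  unfold mixtureKernel Function.uncurry
  fun_prop

theorem mixtureKernel_nonneg (x : E d) {t : ℝ} (ht : t ∈ Set.Ioc (0 : ℝ) 1) :
    0 ≤ mixtureKernel d x t := by
  have := ht.1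
  unfold mixtureKernel
  positivity

theorem fball_nonneg (x : E d) : 0 ≤ fball d x := by
  have hd0 : (0 : ℝ) ≤ d := Nat.cast_nonneg d
  have h1 : 0 < Real.Gamma ((d : ℝ) + 1 / 2) := Real.Gamma_pos_of_pos (by linarith)
  have h2 : 0 < Real.Gamma (((d : ℝ) + 1) / 2) := Real.Gamma_pos_of_pos (by linarith)
  rw [fball_eq_setIntegral]
  refine mul_nonneg ?_ (setIntegral_nonneg measurableSet_Ioc fun t ht => mixtureKernel_nonneg x ht)
  unfold fballConst
  positivity

theorem measurable_fball : Measurable (fball d) := by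
  rw [funext (fball_eq_setIntegral (d := d))]
  exact (measurable_uncurry_mixtureKernel.stronglyMeasurable.integral_prod_right).measurable.const_mul
    _

theorem finrank_div_two_lt : (Module.finrank ℝ (E d) : ℝ) / 2 < (d : ℝ) + 1 / 2 := by
  rw [finrank_E]
  linarith [Nat.cast_nonneg (α := ℝ) d]

theorem integrable_mixtureKernel_left {t : ℝ} (ht : 0 < t) :
    Integrable fun x : E d => mixtureKernel d x t := by
  have := (integrable_add_mul_norm_sq_rpow_neg (V := E d) one_pos ht
    finrank_div_two_lt).const_mul (t ^ (((d : ℝ) - 1) / 2))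
  rw [neg_add'] at this
  exact this

theorem integral_mixtureKernel_left {t : ℝ} (ht : 0 < t) :
    ∫ x : E d, mixtureKernel d x t = studentMass d * t ^ (-(1 / 2) : ℝ) := by
  have h := integral_add_mul_norm_sq_rpow_neg (V := E d) one_pos ht finrank_div_two_lt
  rw [finrank_E, Real.one_rpow, one_mul, neg_add',
    show (d : ℝ) + 1 / 2 - d / 2 = (d + 1) / 2 by ring] at h
  simp only [mixtureKernel]
  rw [integral_const_mul, h, ← mul_assoc, ← Real.rpow_add ht, mul_comm, studentMass]
  congr 2
  ring

theorem integrable_uncurry_mixtureKernel :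
    Integrable (Function.uncurry (mixtureKernel d))
      ((volume : Measure (E d)).prod (volume.restrict (Set.Ioc (0 : ℝ) 1))) := by
  refine (integrable_prod_iff'
    measurable_uncurry_mixtureKernel.aestronglyMeasurable).2 ⟨?_, ?_⟩
  · filter_upwards [ae_restrict_mem measurableSet_Ioc] with t ht
    exact integrable_mixtureKernel_left ht.1
  · have hr : IntegrableOn (fun t : ℝ => t ^ (-(1 / 2) : ℝ)) (Set.Ioc 0 1) :=
      (intervalIntegrable_iff_integrableOn_Ioc_of_le zero_le_one).1
        (intervalIntegral.intervalIntegrable_rpow' (by norm_num))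
    refine (hr.integrable.const_mul (studentMass d)).congr ?_
    filter_upwards [ae_restrict_mem measurableSet_Ioc] with t ht
    rw [← integral_mixtureKernel_left ht.1]
    exact integral_congr_ae (Eventually.of_forall fun x =>
      (Real.norm_of_nonneg (mixtureKernel_nonneg x ht)).symm)

theorem integrable_fball : Integrable (fball d) := by
  rw [funext (fball_eq_setIntegral (d := d))]
  exact integrable_uncurry_mixtureKernel.integral_prod_left.const_mul _

theorem integral_fball : ∫ x : E d, fball d x = 1 := by
  simp_rw [fball_eq_setIntegral]
  rw [integral_const_mul, integral_integral_swap integrable_uncurry_mixtureKernel,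
    setIntegral_congr_fun measurableSet_Ioc fun t ht => integral_mixtureKernel_left ht.1,
    integral_const_mul, ← mul_assoc, fballConst_mul_studentMass,
    ← intervalIntegral.integral_of_le zero_le_one, integral_rpow (Or.inl (by norm_num))]
  norm_num

theorem isProbabilityMeasure_ballPert : IsProbabilityMeasure (ballPert d) := by
  refine ⟨?_⟩
  rw [ballPert, withDensity_apply _ MeasurableSet.univ, Measure.restrict_univ,
    ← ofReal_integral_eq_lintegral_ofReal integrable_fball (Eventually.of_forall fball_nonneg),
    integral_fball, ENNReal.ofReal_one]

theorem integral_inv_sqrt_one_add_mul {c : ℝ} (hc : 0 ≤ c) :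
    ∫ t in (0 : ℝ)..1, (√(1 + t * c))⁻¹ = 2 / (1 + √(1 + c)) := by
  have hderiv : ∀ t ∈ Set.uIcc (0 : ℝ) 1,
      HasDerivAt (fun t : ℝ => 2 * t / (1 + √(1 + t * c))) (√(1 + t * c))⁻¹ t := by
    intro t ht
    rw [Set.uIcc_of_le zero_le_one] at ht
    have h0 : 0 < 1 + t * c := by nlinarith [mul_nonneg ht.1 hc]
    have hp : 0 < √(1 + t * c) := Real.sqrt_pos.2 h0
    have hs : √(1 + t * c) ^ 2 = 1 + t * c := Real.sq_sqrt h0.le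
    have h1 : HasDerivAt (fun t : ℝ => 1 + √(1 + t * c)) (c / (2 * √(1 + t * c))) t := by
      simpa using ((((hasDerivAt_id t).mul_const c).const_add 1).sqrt h0.ne').const_add 1
    have h2 := ((hasDerivAt_id t).const_mul 2).div h1 (by positivity)
    convert! h2 using 1
    simp only [id]
    field_simp
    nlinarith
  have hcont : ContinuousOn (fun t : ℝ => (√(1 + t * c))⁻¹) (Set.uIcc 0 1) := by
    refine ContinuousOn.inv₀ (by fun_prop) fun t ht => ?_
    rw [Set.uIcc_of_le zero_le_one] at ht
    have h0 : 0 < 1 + t * c := by nlinarith [mul_nonneg ht.1 hc]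
    exact (Real.sqrt_pos.2 h0).ne'
  rw [intervalIntegral.integral_eq_sub_of_hasDerivAt hderiv hcont.intervalIntegrable]
  simp

theorem integral_fball_smul_direction (hd : d ≠ 0) (θ : E d) :
    ∫ x : E d, fball d x • direction (θ + x) = (1 + √(1 + ‖θ‖ ^ 2))⁻¹ • θ := by
  have hint : Integrable (Function.uncurry fun (x : E d) (t : ℝ) =>
      mixtureKernel d x t • direction (θ + x))
      ((volume : Measure (E d)).prod (volume.restrict (Set.Ioc (0 : ℝ) 1))) := by
    have hmeas : Measurable fun p : E d × ℝ => direction (θ + p.1) :=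
      measurable_direction.comp (measurable_fst.const_add θ)
    have hbound : ∀ p : E d × ℝ, ‖direction (θ + p.1)‖ ≤ 1 :=
      fun p => norm_direction_le_one (θ + p.1)
    exact integrable_uncurry_mixtureKernel.smul_bdd 1 hmeas.aestronglyMeasurable
      (Eventually.of_forall hbound)
  simp_rw [fball_eq_setIntegral, mul_smul, ← integral_smul_const]
  rw [integral_smul, integral_integral_swap hint]
  have hinner : ∀ t ∈ Set.Ioc (0 : ℝ) 1, ∫ x : E d, mixtureKernel d x t • direction (θ + x) =
      (studentMass d * (√(1 + t * ‖θ‖ ^ 2))⁻¹) • θ := fun t ht =>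
    integral_scaled_studentKernel_smul_direction hd θ ht.1
  rw [setIntegral_congr_fun measurableSet_Ioc hinner, integral_smul_const, integral_const_mul,
    ← intervalIntegral.integral_of_le zero_le_one, integral_inv_sqrt_one_add_mul (sq_nonneg _),
    smul_smul, ← mul_assoc, fballConst_mul_studentMass]
  congr 1
  ring

theorem integral_gradient_suppFun_ballPert (hd : d ≠ 0) (θ : E d) :
    ∫ z, gradient (suppFun (ball d)) (θ + z) ∂(ballPert d) =
      (1 + √(1 + ‖θ‖ ^ 2))⁻¹ • θ := by
  rw [ballPert, integral_withDensity_eq_integral_toReal_smul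
    measurable_fball.ennreal_ofReal (Eventually.of_forall fun _ => ENNReal.ofReal_lt_top),
    ← integral_fball_smul_direction hd θ]
  have : Nonempty (Fin d) := ⟨⟨0, Nat.pos_of_ne_zero hd⟩⟩
  have hae : ∀ᵐ z : E d, z ≠ -θ := compl_mem_ae_iff.2 (measure_singleton _)
  refine integral_congr_ae (hae.mono fun z hz => ?_)
  have hne : θ + z ≠ 0 := fun h => hz (neg_eq_of_add_eq_zero_right h).symm
  simp only [ENNReal.toReal_ofReal (fball_nonneg z), gradient_suppFun_ball hne, direction]

end BallPerturbation

/-- For `d ≥ 2` and `θ ≠ 0`,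
`∫ (θ+x)/‖θ+x‖ · f(x) dx = θ(√(1+‖θ‖²)−1)/‖θ‖²`; in other words, the distribution with
density `fball d` is a `1`-self-concordant perturbation for the unit ball replicating the
`1`-self-concordant barrier `R(z) = −ln(1−‖z‖²)`, whose conjugate satisfies
`∇R*(θ) = θ(√(1+‖θ‖²)−1)/‖θ‖²`. -/
theorem statement14 {d : ℕ} (hd : 2 ≤ d) :
    (∀ θ : E d, θ ≠ 0 →
      (∫ x : E d, fball d x • (‖θ + x‖⁻¹ • (θ + x))) =
        ((Real.sqrt (1 + ‖θ‖^2) - 1) / ‖θ‖^2) • θ) ∧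
    (∀ θ : E d, θ ≠ 0 →
      gradient (conjOn (ball d) (Rball d)) θ =
        ((Real.sqrt (1 + ‖θ‖^2) - 1) / ‖θ‖^2) • θ) ∧
    IsProbabilityMeasure (ballPert d) ∧
    (ballPert d ≪ volume) ∧
    IsSelfConcordantBarrier (ball d) 1 (Rball d) ∧
    (∀ θ : E d, gradient (conjOn (ball d) (Rball d)) θ =
      ∫ z, gradient (suppFun (ball d)) (θ + z) ∂(ballPert d)) := by
  have hd0 : d ≠ 0 := by omega
  refine ⟨fun θ hθ => ?_, fun θ hθ => ?_, isProbabilityMeasure_ballPert,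
    withDensity_absolutelyContinuous _ _, isSelfConcordantBarrier_Rball d, fun θ => ?_⟩
  · rw [sqrt_sub_one_div_norm_sq hθ]
    exact integral_fball_smul_direction hd0 θ
  · rw [sqrt_sub_one_div_norm_sq hθ]
    exact gradient_conjOn_Rball θ
  · rw [gradient_conjOn_Rball, integral_gradient_suppFun_ballPert hd0]
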